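/- For all integers s ≥ 1 and n, k ≥ 1, the Lah numbers of order s satisfy the recurrence T_s(n,k) = T_s(n−1,k−1) + ((n−1)^s + k^s) · T_s(n−1,k), together with the boundary conditions T_s(n,n) = 1 for all n ≥ 0 and T_s(n,0) = T_s(0,n) = 0 for n > 0. -/

import Mathlib

open Finset Polynomial

/-- Lah numbers with higher level: `lahH s n k` satisfies
`lahH s 0 0 = 1`, `lahH s n 0 = lahH s 0 k = 0` for `n, k > 0`, and
`lahH s n k = lahH s (n-1) (k-1) + (n+k-1)^s * lahH s (n-1) k` for `n, k ≥ 1`. -/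
def lahH (s : ℕ) : ℕ → ℕ → ℕ
  | 0, 0 => 1
  | 0, _ + 1 => 0
  | _ + 1, 0 => 0
  | n + 1, k + 1 => lahH s n k + (n + k + 1) ^ s * lahH s n (k + 1)

/-- Stirling numbers of the first kind with higher level. -/
def stirling1H (s : ℕ) : ℕ → ℕ → ℕ
  | 0, 0 => 1
  | 0, _ + 1 => 0
  | _ + 1, 0 => 0
  | n + 1, k + 1 => stirling1H s n k + n ^ s * stirling1H s n (k + 1)

/-- Stirling numbers of the second kind with higher level. -/
def stirling2H (s : ℕ) : ℕ → ℕ → ℕ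
  | 0, 0 => 1
  | 0, _ + 1 => 0
  | _ + 1, 0 => 0
  | n + 1, k + 1 => stirling2H s n k + (k + 1) ^ s * stirling2H s n (k + 1)

/-- Ordinary Stirling numbers of the second kind. -/
def stirling2 : ℕ → ℕ → ℕ
  | 0, 0 => 1
  | 0, _ + 1 => 0
  | _ + 1, 0 => 0
  | n + 1, k + 1 => stirling2 n k + (k + 1) * stirling2 n (k + 1)

/-- Lah numbers of order `s`: `lahOrd s n k = ∑_{j=k}^{n} c_s(n,j) * S_s(j,k)`. -/
def lahOrd (s n k : ℕ) : ℕ := ∑ j ∈ Finset.Icc k n, stirling1H s n j * stirling2H s j k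

/-- Lah polynomial with higher level `L_n^s(x) = ∑_{k=0}^{n} L_s(n,k) x^k`. -/
noncomputable def lahHPoly (s n : ℕ) : Polynomial ℤ :=
  ∑ k ∈ Finset.range (n + 1), Polynomial.C (lahH s n k : ℤ) * Polynomial.X ^ k

/-- Lah polynomial of order `s`: `ℒ_n^s(x) = ∑_{k=0}^{n} T_s(n,k) x^k`. -/
noncomputable def lahOrdPoly (s n : ℕ) : Polynomial ℤ :=
  ∑ k ∈ Finset.range (n + 1), Polynomial.C (lahOrd s n k : ℤ) * Polynomial.X ^ k

theorem stirling1H_eq_zero_of_lt (s : ℕ) {n k : ℕ} (h : n < k) : stirling1H s n k = 0 := by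
  induction n generalizing k with
  | zero => obtain ⟨k, rfl⟩ := Nat.exists_eq_add_of_lt h; simp [stirling1H]
  | succ n ih =>
    cases k with
    | zero => omega
    | succ k => simp [stirling1H, ih (show n < k by omega), ih (show n < k + 1 by omega)]

theorem stirling2H_eq_zero_of_lt (s : ℕ) {n k : ℕ} (h : n < k) : stirling2H s n k = 0 := by
  induction n generalizing k with
  | zero => obtain ⟨k, rfl⟩ := Nat.exists_eq_add_of_lt h; simp [stirling2H]
  | succ n ih =>
    cases k with
    | zero => omega
    | succ k => simp [stirling2H, ih (show n < k by omega), ih (show n < k + 1 by omega)]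

theorem stirling1H_self (s n : ℕ) : stirling1H s n n = 1 := by
  induction n with
  | zero => rfl
  | succ n ih => simp [stirling1H, ih, stirling1H_eq_zero_of_lt s (Nat.lt_succ_self n)]

theorem stirling2H_self (s n : ℕ) : stirling2H s n n = 1 := by
  induction n with
  | zero => rfl
  | succ n ih => simp [stirling2H, ih, stirling2H_eq_zero_of_lt s (Nat.lt_succ_self n)]

theorem lahOrd_eq_sum_range (s k : ℕ) {n m : ℕ} (h : n < m) :
    lahOrd s n k = ∑ j ∈ Finset.range m, stirling1H s n j * stirling2H s j k := by
  refine Finset.sum_subset (fun j hj => ?_) (fun j _ hj => ?_)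
  · rw [Finset.mem_Icc] at hj
    exact Finset.mem_range.2 (by omega)
  · rw [Finset.mem_Icc, not_and_or, not_le, not_le] at hj
    rcases hj with hj | hj
    · rw [stirling2H_eq_zero_of_lt s hj, mul_zero]
    · rw [stirling1H_eq_zero_of_lt s hj, zero_mul]

theorem lahOrd_succ_succ (s n k : ℕ) :
    lahOrd s (n + 1) (k + 1) =
      lahOrd s n k + (n ^ s + (k + 1) ^ s) * lahOrd s n (k + 1) := by
  have shifted : lahOrd s n (k + 1) =
      ∑ j ∈ Finset.range (n + 1), stirling1H s n (j + 1) * stirling2H s (j + 1) (k + 1) := by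
    rw [lahOrd_eq_sum_range s (k + 1) (show n < n + 1 + 1 by omega), Finset.sum_range_succ',
      stirling2H_eq_zero_of_lt s k.succ_pos, mul_zero, add_zero]
  rw [add_mul]
  nth_rewrite 1 [shifted]
  rw [lahOrd_eq_sum_range s (k + 1) (Nat.lt_succ_self (n + 1)), Finset.sum_range_succ',
    stirling2H_eq_zero_of_lt s k.succ_pos, mul_zero, add_zero,
    lahOrd_eq_sum_range s k (Nat.lt_succ_self n),
    lahOrd_eq_sum_range s (k + 1) (Nat.lt_succ_self n),
    Finset.mul_sum, Finset.mul_sum, ← Finset.sum_add_distrib, ← Finset.sum_add_distrib]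
  refine Finset.sum_congr rfl fun j _ => ?_
  simp only [stirling1H, stirling2H]
  ring

theorem lahOrd_self (s n : ℕ) : lahOrd s n n = 1 := by
  simp [lahOrd, stirling1H_self, stirling2H_self]

theorem lahOrd_succ_zero (s n : ℕ) : lahOrd s (n + 1) 0 = 0 := by
  refine Finset.sum_eq_zero fun j _ => ?_
  cases j <;> simp [stirling1H, stirling2H]

theorem lahOrd_zero_succ (s n : ℕ) : lahOrd s 0 (n + 1) = 0 := by
  simp [lahOrd]

theorem lahOrd_rec (s : ℕ) (hs : 1 ≤ s) :
    (∀ n k : ℕ, 1 ≤ n → 1 ≤ k →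
      lahOrd s n k =
        lahOrd s (n - 1) (k - 1) + ((n - 1) ^ s + k ^ s) * lahOrd s (n - 1) k) ∧
    (∀ n : ℕ, lahOrd s n n = 1) ∧
    (∀ n : ℕ, 0 < n → lahOrd s n 0 = 0 ∧ lahOrd s 0 n = 0) := by
  refine ⟨fun n k hn hk => ?_, lahOrd_self s, fun n hn => ?_⟩
  · obtain ⟨n, rfl⟩ := Nat.exists_eq_add_of_le' hn
    obtain ⟨k, rfl⟩ := Nat.exists_eq_add_of_le' hk
    exact lahOrd_succ_succ s n k
  · obtain ⟨n, rfl⟩ := Nat.exists_eq_add_of_le' hn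
    exact ⟨lahOrd_succ_zero s n, lahOrd_zero_succ s n⟩
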